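/- arXiv:2410.09435 — 11 statements merged into one kernel-verified Lean document; each statement's English description precedes it below -/
import Mathlib

section
/- For any q ∈ (ℝ≥0)^n and any two firms i, j, setting Q = q_i − q_j and Δc = c_i − c_j, the updated quantities satisfy min{0, (Q − Δc)/2} ≤ BR(q)_i − BR(q)_j ≤ max{0, (Q − Δc)/2}. -/
/-- Cournot best-response map: `BR n A c q i = max {0, (A − Σ_{j≠i} q_j − c_i)/2}`. -/
noncomputable def BR (n : ℕ) (A : ℝ) (c : Fin n → ℝ) (q : Fin n → ℝ) : Fin n → ℝ :=
  fun i => max 0 ((A - ∑ j ∈ Finset.univ.erase i, q j - c i) / 2)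

/-- one-step contraction bound on differences of best responses. -/
theorem stmt_1 (n : ℕ) (A : ℝ) (hA : 0 < A) (c : Fin n → ℝ) (hc : ∀ i, 0 ≤ c i)
    (q : Fin n → ℝ) (hq : ∀ i, 0 ≤ q i) (i j : Fin n) :
    min 0 (((q i - q j) - (c i - c j)) / 2) ≤ BR n A c q i - BR n A c q j ∧
    BR n A c q i - BR n A c q j ≤ max 0 (((q i - q j) - (c i - c j)) / 2) := by
  have sum_erase (k : Fin n) : ∑ l ∈ Finset.univ.erase k, q l = ∑ l, q l - q k :=
    eq_sub_of_add_eq (Finset.sum_erase_add _ _ (Finset.mem_univ k))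
  simp only [BR, sum_erase]
  constructor <;> grind
end

section
/- If two firms i, j have equal costs c_i = c_j, then for every q ∈ (ℝ≥0)^n one has |BR(q)_i − BR(q)_j| ≤ |q_i − q_j|/2; consequently, along any best-response trajectory (q^t), the difference q_i^t − q_j^t converges to 0 as t → ∞. -/
/-- Firms with equal costs have best responses at most half as far apart as their quantities. -/
theorem abs_BR_sub_BR_le (n : ℕ) (A : ℝ) (c : Fin n → ℝ) {i j : Fin n} (hcij : c i = c j)
    (q : Fin n → ℝ) : |BR n A c q i - BR n A c q j| ≤ |q i - q j| / 2 := by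
  have hi := Finset.sum_erase_eq_sub (f := q) (Finset.mem_univ i)
  have hj := Finset.sum_erase_eq_sub (f := q) (Finset.mem_univ j)
  unfold BR
  rw [hi, hj, hcij, max_comm 0, max_comm 0]
  refine (abs_max_sub_max_le_abs _ _ _).trans_eq ?_
  rw [show |q i - q j| / 2 = |(q i - q j) / 2| by rw [abs_div, abs_two]]
  congr 1
  ring

/-- A real sequence whose absolute value at least halves at each step tends to zero. -/
theorem tendsto_zero_of_abs_succ_le_half {u : ℕ → ℝ} (hu : ∀ t, |u (t + 1)| ≤ |u t| / 2) :
    Filter.Tendsto u Filter.atTop (nhds 0) := by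
  have bound : ∀ t, |u t| ≤ |u 0| * (1 / 2) ^ t := by
    intro t
    induction t with
    | zero => simp
    | succ t ih =>
      rw [pow_succ]
      linarith [hu t]
  refine squeeze_zero_norm bound ?_
  simpa using (tendsto_pow_atTop_nhds_zero_of_lt_one (r := (1 / 2 : ℝ))
    (by norm_num) (by norm_num)).const_mul |u 0|

/-- equal costs give halving of quantity differences, hence convergence to 0. -/
theorem stmt_3 (n : ℕ) (A : ℝ) (hA : 0 < A) (c : Fin n → ℝ) (hc : ∀ i, 0 ≤ c i)
    (i j : Fin n) (hcij : c i = c j) :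
    (∀ q : Fin n → ℝ, (∀ k, 0 ≤ q k) →
      |BR n A c q i - BR n A c q j| ≤ |q i - q j| / 2) ∧
    (∀ q : ℕ → Fin n → ℝ, (∀ t k, 0 ≤ q t k) → (∀ t, q (t + 1) = BR n A c (q t)) →
      Filter.Tendsto (fun t => q t i - q t j) Filter.atTop (nhds 0)) := by
  refine ⟨fun q _ => abs_BR_sub_BR_le n A c hcij q, fun q _ hq => ?_⟩
  refine tendsto_zero_of_abs_succ_le_half fun t => ?_
  rw [hq t]
  exact abs_BR_sub_BR_le n A c hcij (q t)
end

section
/- Let (q^t)_{t≥0} be a best-response trajectory and let m ≤ n be such that for every t ≥ 0 and every i ≤ m the best response is interior, i.e., q_i^{t+1} = (A − Σ_{j≠i} q_j^t − c_i)/2 with this value nonnegative. Define averaged costs c̄_i = (1/m)Σ_{j≤m} c_j for i ≤ m and c̄_i = c_i for i > m, and averaged quantities q̄_i^t = (1/m)Σ_{j≤m} q_j^t for i ≤ m and q̄_i^t = q_i^t for i > m. Then (q̄^t)_{t≥0} is a best-response trajectory for the game with costs c̄_1, …, c̄_n (and the same market capacity A). -/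
theorem BR_apply (n : ℕ) (A : ℝ) (c q : Fin n → ℝ) (i : Fin n) :
    BR n A c q i = max 0 ((A - ∑ j, q j + q i - c i) / 2) := by
  rw [BR, Finset.sum_erase_eq_sub (Finset.mem_univ i)]
  ring_nf

/-- Replace the values of `x` on `s` by their mean over `s`. -/
noncomputable def averageOn {ι : Type*} [DecidableEq ι] (s : Finset ι) (x : ι → ℝ) : ι → ℝ :=
  fun i => if i ∈ s then (∑ j ∈ s, x j) / s.card else x i

theorem sum_averageOn {ι : Type*} [Fintype ι] [DecidableEq ι] (s : Finset ι) (x : ι → ℝ) :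
    ∑ i, averageOn s x i = ∑ i, x i := by
  rw [← Finset.sum_add_sum_compl s (averageOn s x), ← Finset.sum_add_sum_compl s x]
  congr 1
  · have hmean : ∀ i ∈ s, averageOn s x i = (∑ j ∈ s, x j) / s.card := fun i hi => if_pos hi
    rw [Finset.sum_congr rfl hmean, Finset.sum_const, nsmul_eq_mul]
    rcases s.eq_empty_or_nonempty with rfl | hs
    · simp
    · have : (s.card : ℝ) ≠ 0 := Nat.cast_ne_zero.mpr hs.card_pos.ne'
      field_simp
  · exact Finset.sum_congr rfl fun i hi => if_neg (Finset.mem_compl.mp hi)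

/-- Averaging over a set of firms with interior best responses commutes with the
best-response map. -/
theorem averageOn_BR {n : ℕ} {A : ℝ} {c q : Fin n → ℝ} {s : Finset (Fin n)}
    (hs : ∀ i ∈ s, 0 ≤ A - ∑ j, q j + q i - c i) :
    averageOn s (BR n A c q) = BR n A (averageOn s c) (averageOn s q) := by
  funext i
  rw [BR_apply, sum_averageOn]
  by_cases hi : i ∈ s
  · have hcard : (s.card : ℝ) ≠ 0 := Nat.cast_ne_zero.mpr (Finset.card_pos.mpr ⟨i, hi⟩).ne'
    have hsum : ∑ j ∈ s, (A - ∑ k, q k + q j - c j) =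
        s.card * (A - ∑ k, q k) + ∑ j ∈ s, q j - ∑ j ∈ s, c j := by
      rw [Finset.sum_sub_distrib, Finset.sum_add_distrib, Finset.sum_const, nsmul_eq_mul]
    have hBR : ∑ j ∈ s, BR n A c q j = (∑ j ∈ s, (A - ∑ k, q k + q j - c j)) / 2 := by
      rw [Finset.sum_div]
      refine Finset.sum_congr rfl fun j hj => ?_
      rw [BR_apply, max_eq_right (div_nonneg (hs j hj) zero_le_two)]
    have hmean : (A - ∑ k, q k + (∑ j ∈ s, q j) / s.card - (∑ j ∈ s, c j) / s.card) / 2 =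
        (∑ j ∈ s, (A - ∑ k, q k + q j - c j)) / 2 / s.card := by
      rw [hsum]
      field_simp
    simp only [averageOn, if_pos hi]
    rw [hBR, hmean, max_eq_right]
    exact div_nonneg (div_nonneg (Finset.sum_nonneg hs) zero_le_two) (Nat.cast_nonneg _)
  · simp only [averageOn, if_neg hi, BR_apply]

/-- averaging the first m (interior) firms yields a best-response
trajectory for the averaged-cost game. -/
theorem stmt_4 (n m : ℕ) (hm : m ≤ n) (A : ℝ) (hA : 0 < A)
    (c : Fin n → ℝ) (hc : ∀ i, 0 ≤ c i)
    (q : ℕ → Fin n → ℝ) (hq : ∀ t i, 0 ≤ q t i)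
    (hBR : ∀ t, q (t + 1) = BR n A c (q t))
    (hint : ∀ t : ℕ, ∀ i : Fin n, i.val < m →
      0 ≤ A - (∑ j ∈ Finset.univ.erase i, q t j) - c i ∧
      q (t + 1) i = (A - (∑ j ∈ Finset.univ.erase i, q t j) - c i) / 2)
    (cbar : Fin n → ℝ)
    (hcbar : ∀ i : Fin n, cbar i =
      if i.val < m then (∑ j ∈ Finset.univ.filter (fun j : Fin n => j.val < m), c j) / m
      else c i)
    (qbar : ℕ → Fin n → ℝ)
    (hqbar : ∀ t : ℕ, ∀ i : Fin n, qbar t i =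
      if i.val < m then (∑ j ∈ Finset.univ.filter (fun j : Fin n => j.val < m), q t j) / m
      else q t i) :
    ∀ t, qbar (t + 1) = BR n A cbar (qbar t) := by
  let s : Finset (Fin n) := Finset.univ.filter fun j => j.val < m
  have hcard : s.card = m := by
    simp [s, Fin.card_filter_val_lt, hm]
  have hc_avg : cbar = averageOn s c := by
    funext i
    simp [hcbar, averageOn, hcard, s]
  have hq_avg : ∀ t, qbar t = averageOn s (q t) := by
    intro t
    funext i
    simp [hqbar, averageOn, hcard, s]
  intro t
  rw [hq_avg, hq_avg, hc_avg, hBR]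
  refine averageOn_BR fun i hi => ?_
  have h := (hint t i (by simpa [s] using hi)).1
  rw [Finset.sum_erase_eq_sub (Finset.mem_univ i)] at h
  linarith
end

section
/- Every periodic point of the best-response dynamics has period at most two: if q ∈ (ℝ≥0)^n satisfies BR^T(q) = q for some integer T ≥ 1 (where BR^T denotes the T-fold iterate), then BR(BR(q)) = q. -/
/-- Twice the energy of a pair of consecutive output vectors. Up to terms independent of `p`,
`p ↦ energy n A c p q` is minimized over nonnegative `p` exactly at `BR n A c q`. -/
noncomputable def energy (n : ℕ) (A : ℝ) (c p q : Fin n → ℝ) : ℝ :=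
  ∑ i, (p i ^ 2 + q i ^ 2 - (p i + q i) * (A - c i) - p i * q i) + (∑ i, p i) * ∑ i, q i

theorem BR_nonneg (n : ℕ) (A : ℝ) (c q : Fin n → ℝ) (i : Fin n) : 0 ≤ BR n A c q i :=
  le_max_left _ _

theorem BR_eq (n : ℕ) (A : ℝ) (c q : Fin n → ℝ) (i : Fin n) :
    BR n A c q i = max 0 ((A - c i + q i - ∑ j, q j) / 2) := by
  have h := Finset.add_sum_erase Finset.univ q (Finset.mem_univ i)
  unfold BR
  rw [← h]
  congr 2
  ring

theorem energy_sub_energy (n : ℕ) (A : ℝ) (c p q r : Fin n → ℝ) :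
    energy n A c q r - energy n A c p q =
      ∑ i, (r i ^ 2 - p i ^ 2 - 2 * (r i - p i) * ((A - c i + q i - ∑ j, q j) / 2)) := by
  have h : (∑ i, q i) * ∑ i, r i - (∑ i, p i) * ∑ i, q i =
      ∑ i, (r i - p i) * ∑ j, q j := by
    rw [← Finset.sum_mul, Finset.sum_sub_distrib]
    ring
  unfold energy
  rw [add_sub_add_comm, h, ← Finset.sum_sub_distrib, ← Finset.sum_add_distrib]
  refine Finset.sum_congr rfl fun i _ => ?_
  ring

theorem sq_sub_max_zero_le {p u : ℝ} (hp : 0 ≤ p) :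
    max 0 u ^ 2 - p ^ 2 - 2 * (max 0 u - p) * u ≤ -(max 0 u - p) ^ 2 := by
  rcases le_total 0 u with hu | hu
  · rw [max_eq_right hu]
    nlinarith
  · rw [max_eq_left hu]
    nlinarith [mul_nonneg hp (neg_nonneg.2 hu)]

theorem energy_BR_add_le (n : ℕ) (A : ℝ) (c p q : Fin n → ℝ) (hp : ∀ i, 0 ≤ p i) :
    energy n A c q (BR n A c q) + ∑ i, (BR n A c q i - p i) ^ 2 ≤ energy n A c p q := by
  have h : energy n A c q (BR n A c q) - energy n A c p q ≤
      ∑ i, -(BR n A c q i - p i) ^ 2 := by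
    rw [energy_sub_energy]
    refine Finset.sum_le_sum fun i _ => ?_
    rw [BR_eq]
    exact sq_sub_max_zero_le (hp i)
  rw [Finset.sum_neg_distrib] at h
  linarith

theorem iterate_BR_nonneg (n : ℕ) (A : ℝ) (c q : Fin n → ℝ) (hq : ∀ i, 0 ≤ q i) (k : ℕ) :
    ∀ i, 0 ≤ (BR n A c)^[k] q i := by
  cases k with
  | zero => exact hq
  | succ k =>
    rw [Function.iterate_succ_apply']
    exact BR_nonneg n A c _

theorem antitone_energy_iterate (n : ℕ) (A : ℝ) (c q : Fin n → ℝ) (hq : ∀ i, 0 ≤ q i) :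
    Antitone fun k => energy n A c ((BR n A c)^[k] q) (BR n A c ((BR n A c)^[k] q)) := by
  refine antitone_nat_of_succ_le fun k => ?_
  have h := energy_BR_add_le n A c _ (BR n A c ((BR n A c)^[k] q))
    (iterate_BR_nonneg n A c q hq k)
  rw [Function.iterate_succ_apply']
  exact (le_add_of_nonneg_right (Finset.sum_nonneg fun i _ => sq_nonneg _)).trans h

/-- every periodic point of the best-response dynamics has period at most two. -/
theorem stmt_8 (n : ℕ) (A : ℝ) (hA : 0 < A) (c : Fin n → ℝ) (hc : ∀ i, 0 ≤ c i)
    (q : Fin n → ℝ) (hq : ∀ i, 0 ≤ q i)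
    (T : ℕ) (hT : 1 ≤ T) (hper : (BR n A c)^[T] q = q) :
    BR n A c (BR n A c q) = q := by
  have h₁ := antitone_energy_iterate n A c q hq hT
  have h₂ := energy_BR_add_le n A c q (BR n A c q) hq
  simp only [hper, Function.iterate_one] at h₁
  have h₀ : ∑ i, (BR n A c (BR n A c q) i - q i) ^ 2 = 0 :=
    le_antisymm (by linarith) (Finset.sum_nonneg fun i _ => sq_nonneg _)
  rw [Finset.sum_eq_zero_iff_of_nonneg fun i _ => sq_nonneg _] at h₀
  funext i
  exact sub_eq_zero.1 (pow_eq_zero_iff two_ne_zero |>.1 (h₀ i (Finset.mem_univ i)))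
end

section
/- Suppose q ∈ (ℝ≥0)^n satisfies BR^T(q) = q for some integer T ≥ 1, and suppose every coordinate of every iterate BR^s(q) (s ≥ 0) is strictly positive. Then for every s ≥ 0 and every pair of firms i, j, one has BR^s(q)_i − BR^s(q)_j = c_j − c_i; in particular, the quantity differences between any two firms are constant in time and equal to the negative of their cost differences. -/
/-- Where the best response is positive at `i` and `j`, the deviation of the quantity difference
from the negated cost difference is halved. -/
theorem BR_sub_sub_eq_half {n : ℕ} {A : ℝ} {c q : Fin n → ℝ} {i j : Fin n}
    (hi : 0 < BR n A c q i) (hj : 0 < BR n A c q j) :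
    BR n A c q i - BR n A c q j - (c j - c i) = (q i - q j - (c j - c i)) / 2 := by
  have interior : ∀ k, 0 < BR n A c q k →
      BR n A c q k = (A - (∑ l, q l - q k) - c k) / 2 := by
    intro k hk
    have hsum := Finset.sum_erase_add Finset.univ q (Finset.mem_univ k)
    rw [← hsum, add_sub_cancel_right]
    exact max_eq_right ((lt_max_iff.mp hk).resolve_left (lt_irrefl 0)).le
  rw [interior i hi, interior j hj]
  ring

/-- Along an everywhere-positive orbit, the deviation of the quantity difference from the negated
cost difference decays geometrically with ratio `1 / 2`. -/
theorem BR_iterate_sub_sub_eq {n : ℕ} {A : ℝ} {c q : Fin n → ℝ}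
    (hpos : ∀ s : ℕ, ∀ i, 0 < (BR n A c)^[s] q i) (s : ℕ) (i j : Fin n) :
    (BR n A c)^[s] q i - (BR n A c)^[s] q j - (c j - c i) =
      (q i - q j - (c j - c i)) / 2 ^ s := by
  induction s with
  | zero => simp
  | succ s ih =>
    have hi := hpos (s + 1) i
    have hj := hpos (s + 1) j
    rw [Function.iterate_succ_apply'] at hi hj ⊢
    rw [BR_sub_sub_eq_half hi hj, ih, pow_succ, div_div]

/-- on an everywhere-positive periodic orbit, quantity differences equal
the negated cost differences at all times. -/
theorem stmt_9 (n : ℕ) (A : ℝ) (hA : 0 < A) (c : Fin n → ℝ) (hc : ∀ i, 0 ≤ c i)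
    (q : Fin n → ℝ) (hq : ∀ i, 0 ≤ q i)
    (T : ℕ) (hT : 1 ≤ T) (hper : (BR n A c)^[T] q = q)
    (hpos : ∀ s : ℕ, ∀ i, 0 < (BR n A c)^[s] q i) :
    ∀ s : ℕ, ∀ i j : Fin n,
      (BR n A c)^[s] q i - (BR n A c)^[s] q j = c j - c i := by
  intro s i j
  have hdev := BR_iterate_sub_sub_eq hpos T i j
  have hpow : (1 : ℝ) < 2 ^ T := one_lt_pow₀ one_lt_two (Nat.one_le_iff_ne_zero.mp hT)
  rw [hper, eq_div_iff (by positivity)] at hdev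
  have hzero : q i - q j - (c j - c i) = 0 := by
    by_contra hne
    exact hpow.ne' ((mul_eq_left₀ hne).mp hdev)
  have hs := BR_iterate_sub_sub_eq hpos s i j
  rw [hzero, zero_div] at hs
  exact sub_eq_zero.mp hs
end

section
/- Let (q, q') be a two-period orbit in which every coordinate of q and of q' is strictly positive. Then for every firm i, 3(q_i − q'_i) = Σ_{j=1}^n (q_j − q'_j); consequently the difference q_i − q'_i is the same for all i, and if q ≠ q' then necessarily n = 3. -/
/-- Where the best response is positive, it solves the first-order condition. -/
theorem two_mul_eq_of_BR_pos {n : ℕ} {A : ℝ} {c q : Fin n → ℝ} {i : Fin n}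
    (h : 0 < BR n A c q i) : 2 * BR n A c q i = A - ∑ j, q j + q i - c i := by
  have hs := Finset.add_sum_erase Finset.univ q (Finset.mem_univ i)
  unfold BR at h ⊢
  rw [max_eq_right ((lt_max_iff.mp h).resolve_left (lt_irrefl 0)).le]
  linarith

/-- on an everywhere-positive two-period orbit,
`3(q_i − q'_i) = Σ_j (q_j − q'_j)` for all i; the difference is constant in i,
and a genuine oscillation forces n = 3. -/
theorem stmt_10 (n : ℕ) (A : ℝ) (hA : 0 < A) (c : Fin n → ℝ) (hc : ∀ i, 0 ≤ c i)
    (q q' : Fin n → ℝ) (hq : ∀ i, 0 < q i) (hq' : ∀ i, 0 < q' i)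
    (h1 : q' = BR n A c q) (h2 : q = BR n A c q') :
    (∀ i, 3 * (q i - q' i) = ∑ j, (q j - q' j)) ∧
    (∀ i j, q i - q' i = q j - q' j) ∧
    (q ≠ q' → n = 3) := by
  have key : ∀ i, 3 * (q i - q' i) = ∑ j, (q j - q' j) := by
    intro i
    have e1 := two_mul_eq_of_BR_pos ((congrFun h1 i) ▸ hq' i)
    have e2 := two_mul_eq_of_BR_pos ((congrFun h2 i) ▸ hq i)
    rw [← congrFun h1 i] at e1
    rw [← congrFun h2 i] at e2
    rw [Finset.sum_sub_distrib]
    linarith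
  have const : ∀ i j, q i - q' i = q j - q' j := fun i j => by
    linarith [key i, key j]
  refine ⟨key, const, fun hne => ?_⟩
  obtain ⟨i, hi⟩ := Function.ne_iff.mp hne
  have hsum := key i
  rw [Finset.sum_congr rfl fun j _ => const j i, Finset.sum_const, Finset.card_univ,
    Fintype.card_fin, nsmul_eq_mul] at hsum
  exact_mod_cast (mul_right_cancel₀ (sub_ne_zero.mpr hi) hsum).symm
end

section
/- Let n = 3 and let (q, q') be a two-period orbit with all six quantities q_1, q_2, q_3, q'_1, q'_2, q'_3 strictly positive, and let Δ = q'_1 − q_1 (which then equals q'_i − q_i for every i). Then for each i ∈ {1,2,3}: q_i = (A + Σ_{j≠i} c_j − 3c_i)/4 − Δ/2 and q'_i = (A + Σ_{j≠i} c_j − 3c_i)/4 + Δ/2. -/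
/-- explicit form of the everywhere-positive two-period orbit with 3 firms. -/
theorem stmt_11 (A : ℝ) (hA : 0 < A) (c : Fin 3 → ℝ) (hc : ∀ i, 0 ≤ c i)
    (q q' : Fin 3 → ℝ) (hq : ∀ i, 0 < q i) (hq' : ∀ i, 0 < q' i)
    (h1 : q' = BR 3 A c q) (h2 : q = BR 3 A c q')
    (Δ : ℝ) (hΔ : Δ = q' 0 - q 0) :
    ∀ i : Fin 3,
      q i = (A + (∑ j ∈ Finset.univ.erase i, c j) - 3 * c i) / 4 - Δ / 2 ∧
      q' i = (A + (∑ j ∈ Finset.univ.erase i, c j) - 3 * c i) / 4 + Δ / 2 := by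
  have erase_sum (f : Fin 3 → ℝ) (i : Fin 3) :
      ∑ j ∈ Finset.univ.erase i, f j = f 0 + f 1 + f 2 - f i := by
    rw [Finset.sum_erase_eq_sub (Finset.mem_univ i), Fin.sum_univ_three]
  have interior {x y : Fin 3 → ℝ} (hy : ∀ i, 0 < y i) (h : y = BR 3 A c x) (i : Fin 3) :
      y i = (A - (x 0 + x 1 + x 2 - x i) - c i) / 2 := by
    have hi : y i = max 0 ((A - (x 0 + x 1 + x 2 - x i) - c i) / 2) := by
      rw [← erase_sum]
      exact congrFun h i
    rcases max_choice 0 ((A - (x 0 + x 1 + x 2 - x i) - c i) / 2) with hm | hm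
    · exact absurd (hi.trans hm) (hy i).ne'
    · exact hi.trans hm
  have e := interior hq' h1
  have e' := interior hq h2
  intro i
  rw [erase_sum]
  constructor <;> linarith [e 0, e 1, e 2, e' 0, e' 1, e' 2, e i, e' i]
end

section
/- Assume the costs are sorted, c_1 ≤ c_2 ≤ … ≤ c_n, and let k = #{i : c_i < A} with k ≥ 1. Then BR(0) is the vector with coordinates max{0, (A − c_i)/2} (strictly positive exactly for i ≤ k), and BR(BR(0)) = 0 — i.e., the all-zero vector together with BR(0) forms a two-period orbit in which every firm produces zero in one of the two periods — if and only if (k − 3)A + 3c_1 − Σ_{i=1}^k c_i ≥ 0. -/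
/-- For a monotone vector, the entries below a threshold are exactly the first ones. -/
theorem lt_iff_val_lt_card_filter {n : ℕ} {A : ℝ} {c : Fin n → ℝ}
    (hc : ∀ i j : Fin n, i ≤ j → c i ≤ c j) (i : Fin n) :
    c i < A ↔ i.val < (Finset.univ.filter (fun j : Fin n => c j < A)).card := by
  constructor
  · intro hi
    have h : Finset.Iic i ⊆ Finset.univ.filter (fun j : Fin n => c j < A) := fun j hj => by
      simpa using (hc j i (Finset.mem_Iic.mp hj)).trans_lt hi
    simpa [Nat.succ_le_iff] using Finset.card_le_card h
  · intro hi
    by_contra hci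
    have h : Finset.univ.filter (fun j : Fin n => c j < A) ⊆ Finset.Iio i := fun j hj => by
      rw [Finset.mem_Iio]
      by_contra hij
      exact hci ((hc i j (not_lt.mp hij)).trans_lt (by simpa using hj))
    have := Finset.card_le_card h
    rw [Fin.card_Iio] at this
    omega

theorem BR_zero_apply (n : ℕ) (A : ℝ) (c : Fin n → ℝ) (i : Fin n) :
    BR n A c (fun _ => 0) i = max 0 ((A - c i) / 2) := by
  simp [BR]

theorem BR_apply_eq_zero_iff (n : ℕ) (A : ℝ) (c q : Fin n → ℝ) (i : Fin n) :
    BR n A c q i = 0 ↔ A - c i + q i ≤ ∑ j, q j := by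
  rw [BR, max_eq_left_iff, ← Finset.add_sum_erase _ q (Finset.mem_univ i)]
  constructor <;> intro h <;> linarith

/-- The total output of the best response to zero. -/
theorem sum_BR_zero (n : ℕ) (A : ℝ) (c : Fin n → ℝ) :
    ∑ i, BR n A c (fun _ => 0) i =
      ((Finset.univ.filter (fun i : Fin n => c i < A)).card * A
        - ∑ i ∈ Finset.univ.filter (fun i : Fin n => c i < A), c i) / 2 := by
  have h : ∀ i, BR n A c (fun _ => 0) i = if c i < A then (A - c i) / 2 else 0 := fun i => by
    rw [BR_zero_apply]
    split_ifs with hi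
    · exact max_eq_right (by linarith)
    · exact max_eq_left (by linarith)
  rw [Finset.sum_congr rfl fun i _ => h i, ← Finset.sum_filter, ← Finset.sum_div,
    Finset.sum_sub_distrib, Finset.sum_const, nsmul_eq_mul]

/-- with sorted costs and k firms of cost below A, the zero vector
together with BR(0) forms a two-period orbit iff (k−3)A + 3c_1 − Σ_{i≤k} c_i ≥ 0. -/
theorem stmt_13 (n : ℕ) (hn : 0 < n) (A : ℝ) (hA : 0 < A)
    (c : Fin n → ℝ) (hc : ∀ i, 0 ≤ c i)
    (hsort : ∀ i j : Fin n, i ≤ j → c i ≤ c j)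
    (k : ℕ) (hk : k = (Finset.univ.filter (fun i : Fin n => c i < A)).card)
    (hk1 : 1 ≤ k) :
    (∀ i : Fin n, BR n A c (fun _ => 0) i = max 0 ((A - c i) / 2)) ∧
    (∀ i : Fin n, 0 < BR n A c (fun _ => 0) i ↔ i.val < k) ∧
    (BR n A c (BR n A c (fun _ => 0)) = (fun _ => 0) ↔
      0 ≤ ((k : ℝ) - 3) * A + 3 * c ⟨0, hn⟩
        - ∑ i ∈ Finset.univ.filter (fun i : Fin n => i.val < k), c i) := by
  have hlt : ∀ i : Fin n, c i < A ↔ i.val < k := fun i => by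
    rw [hk]
    exact lt_iff_val_lt_card_filter hsort i
  refine ⟨BR_zero_apply n A c, fun i => ?_, ?_⟩
  · rw [BR_zero_apply, ← hlt i, lt_max_iff]
    simp
  · have hsum := sum_BR_zero n A c
    rw [← hk, Finset.filter_congr fun i _ => hlt i] at hsum
    have h0 : c ⟨0, hn⟩ < A := (hlt _).mpr hk1
    have hq0 : BR n A c (fun _ => 0) ⟨0, hn⟩ = (A - c ⟨0, hn⟩) / 2 := by
      rw [BR_zero_apply]
      exact max_eq_right (by linarith)
    simp only [funext_iff, BR_apply_eq_zero_iff, hsum]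
    constructor
    · intro h
      have := h ⟨0, hn⟩
      rw [hq0] at this
      linarith
    · intro h i
      have hi : c ⟨0, hn⟩ ≤ c i := hsort _ i (Nat.zero_le _)
      have hqi : BR n A c (fun _ => 0) i ≤ (A - c ⟨0, hn⟩) / 2 := by
        rw [BR_zero_apply]
        exact max_le (by linarith) (by linarith)
      linarith
end

section
/- Let k_1, k_2 ≥ 1 be integers, A > 0, y > 0, and let a, b, c > 0 be real numbers satisfying: a = (A − (k_1 − 1)b − k_2·c)/2, b = (A − (k_1 − 1)a)/2, c = (A − k_1·a − y)/2, and 0 ≥ A − k_1·b − (k_2 − 1)c − y. Then k_1 ≤ 2. -/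
/-- the reduced (averaged) two-period oscillation equations force
the number of always-active firms to be at most two. -/
theorem stmt_14 (k₁ k₂ : ℕ) (hk₁ : 1 ≤ k₁) (hk₂ : 1 ≤ k₂)
    (A y a b c : ℝ) (hA : 0 < A) (hy : 0 < y)
    (ha : 0 < a) (hb : 0 < b) (hc : 0 < c)
    (e1 : a = (A - ((k₁ : ℝ) - 1) * b - (k₂ : ℝ) * c) / 2)
    (e2 : b = (A - ((k₁ : ℝ) - 1) * a) / 2)
    (e3 : c = (A - (k₁ : ℝ) * a - y) / 2)
    (e4 : A - (k₁ : ℝ) * b - ((k₂ : ℝ) - 1) * c - y ≤ 0) :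
    k₁ ≤ 2 := by
  by_contra! h
  have hk₁' : (3 : ℝ) ≤ k₁ := by exact_mod_cast h
  have hdiff : ((k₁ : ℝ) - 3) * (a - b) = k₂ * c := by linarith
  have hneg : a - b ≤ 0 := by linarith
  have hpos : 0 < (k₂ : ℝ) * c := by positivity
  linarith [mul_nonpos_of_nonneg_of_nonpos (sub_nonneg.2 hk₁') hneg]
end

section
/- Let (q^t)_{t≥0} be a best-response trajectory, and let m ≤ n and Δ ≥ 1 be such that for all t ≥ 0: (i) for every i ≤ m the best response is interior, q_i^{t+1} = (A − Σ_{j≠i} q_j^t − c_i)/2; (ii) Σ_{i≤m} q_i^{t+Δ} = Σ_{i≤m} q_i^t; and (iii) q_j^{t+Δ} = q_j^t for every j > m. Then for every i ≤ m and all t, r ≥ 0, q_i^{t+Δ+r} − q_i^{t+r} = 2^{−r}(q_i^{t+Δ} − q_i^t); in particular, for each i ≤ m and each residue ℓ, the sequence (q_i^{kΔ+ℓ})_{k≥0} converges as k → ∞. -/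
/-- under interior updates for the first m firms, Δ-periodicity of their
total and of the tail, each of the first m firms geometrically synchronizes across
periods and converges along every residue class. -/
theorem stmt_15 (n m : ℕ) (hm : m ≤ n) (A : ℝ) (hA : 0 < A)
    (c : Fin n → ℝ) (hc : ∀ i, 0 ≤ c i)
    (q : ℕ → Fin n → ℝ) (hq : ∀ t i, 0 ≤ q t i)
    (hBR : ∀ t, q (t + 1) = BR n A c (q t))
    (Δ : ℕ) (hΔ : 1 ≤ Δ)
    (hint : ∀ t : ℕ, ∀ i : Fin n, i.val < m →
      q (t + 1) i = (A - (∑ j ∈ Finset.univ.erase i, q t j) - c i) / 2)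
    (hsum : ∀ t : ℕ,
      ∑ i ∈ Finset.univ.filter (fun i : Fin n => i.val < m), q (t + Δ) i
        = ∑ i ∈ Finset.univ.filter (fun i : Fin n => i.val < m), q t i)
    (htail : ∀ t : ℕ, ∀ j : Fin n, m ≤ j.val → q (t + Δ) j = q t j) :
    (∀ i : Fin n, i.val < m → ∀ t r : ℕ,
      q (t + Δ + r) i - q (t + r) i = (q (t + Δ) i - q t i) / 2 ^ r) ∧
    (∀ i : Fin n, i.val < m → ∀ ℓ : ℕ, ∃ L : ℝ,
      Filter.Tendsto (fun k => q (k * Δ + ℓ) i) Filter.atTop (nhds L)) := by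
  have htotal : ∀ t, ∑ j, q (t + Δ) j = ∑ j, q t j := fun t => by
    rw [← Finset.sum_filter_add_sum_filter_not Finset.univ (fun j : Fin n => j.val < m),
      ← Finset.sum_filter_add_sum_filter_not Finset.univ (fun j : Fin n => j.val < m) (q t),
      hsum t]
    congr 1
    refine Finset.sum_congr rfl fun j hj => htail t j ?_
    simpa using hj
  have hgeom : ∀ i : Fin n, i.val < m → ∀ t r : ℕ,
      q (t + Δ + r) i - q (t + r) i = (q (t + Δ) i - q t i) / 2 ^ r := by
    intro i hi t r
    induction r with
    | zero => simp
    | succ r ih =>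
      have h₁ := Finset.add_sum_erase Finset.univ (q (t + Δ + r)) (Finset.mem_univ i)
      have h₂ := Finset.add_sum_erase Finset.univ (q (t + r)) (Finset.mem_univ i)
      have h₃ := htotal (t + r)
      rw [add_right_comm] at h₃
      rw [← add_assoc, ← add_assoc, hint _ i hi, hint _ i hi, pow_succ, ← div_div, ← ih]
      linarith
  refine ⟨hgeom, fun i hi ℓ => cauchySeq_tendsto_of_complete
    (cauchySeq_of_le_geometric_two (C := 2 * |q (ℓ + Δ) i - q ℓ i|) fun k => ?_)⟩
  have h := hgeom i hi ℓ (k * Δ)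
  rw [dist_comm, Real.dist_eq, show (k + 1) * Δ + ℓ = ℓ + Δ + k * Δ by ring,
    add_comm (k * Δ) ℓ, h, abs_div, abs_of_pos (by positivity : (0 : ℝ) < 2 ^ (k * Δ)),
    mul_div_cancel_left₀ _ (two_ne_zero' ℝ)]
  gcongr
  · norm_num
  · exact Nat.le_mul_of_pos_right k hΔ
end

section
/- Let n = 1 + k_2 with k_2 ≥ 1 and k_2 ≠ 4, and let (q, q') be a two-period orbit in which q_1 > 0 and q'_1 > 0, while q_j = 0 and q'_j > 0 for every j with 2 ≤ j ≤ 1 + k_2. Then q_1 = ((2 − k_2)A + Σ_{j=2}^{1+k_2} c_j − 2c_1)/(4 − k_2), q'_1 = (A − c_1)/2, and q'_j = (A − q_1 − c_j)/2 for every j with 2 ≤ j ≤ 1 + k_2. -/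
/-- explicit two-period orbit when exactly one firm is always active
(k₁ = 1), provided k₂ ≠ 4. -/
theorem stmt_17 (k₂ : ℕ) (hk₂ : 1 ≤ k₂) (hk₂4 : k₂ ≠ 4) (A : ℝ) (hA : 0 < A)
    (c : Fin (k₂ + 1) → ℝ) (hc : ∀ i, 0 ≤ c i)
    (q q' : Fin (k₂ + 1) → ℝ) (hqnn : ∀ i, 0 ≤ q i) (hq'nn : ∀ i, 0 ≤ q' i)
    (h1 : q' = BR (k₂ + 1) A c q) (h2 : q = BR (k₂ + 1) A c q')
    (hpos1 : 0 < q 0 ∧ 0 < q' 0)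
    (hrest : ∀ j : Fin (k₂ + 1), 1 ≤ j.val → q j = 0 ∧ 0 < q' j) :
    q 0 = ((2 - (k₂ : ℝ)) * A
        + (∑ j ∈ Finset.univ.filter (fun j : Fin (k₂ + 1) => 1 ≤ j.val), c j)
        - 2 * c 0) / (4 - (k₂ : ℝ)) ∧
    q' 0 = (A - c 0) / 2 ∧
    (∀ j : Fin (k₂ + 1), 1 ≤ j.val → q' j = (A - q 0 - c j) / 2) := by
  have act {x y : ℝ} (hx : 0 < x) (h : x = max 0 y) : x = y := by
    rcases max_choice 0 y with h' | h' <;> linarith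
  have erase_sum (p : Fin (k₂ + 1) → ℝ) (i : Fin (k₂ + 1)) :
      ∑ j ∈ Finset.univ.erase i, p j = p 0 + ∑ j : Fin k₂, p j.succ - p i := by
    rw [← Fin.sum_univ_succ, Finset.sum_erase_eq_sub (Finset.mem_univ i)]
  have filter_sum : ∑ j ∈ Finset.univ.filter (fun j : Fin (k₂ + 1) => 1 ≤ j.val), c j
      = ∑ j : Fin k₂, c j.succ := by
    rw [Finset.sum_filter, Fin.sum_univ_succ]
    simp
  have succ_pos (j : Fin k₂) : 1 ≤ (j.succ).val := by simp
  have q_succ : ∑ j : Fin k₂, q j.succ = 0 :=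
    Finset.sum_eq_zero fun j _ => (hrest j.succ (succ_pos j)).1
  have hq0 := act hpos1.1 (congrFun h2 0)
  have hq'0 := act hpos1.2 (congrFun h1 0)
  have hq'j (j : Fin (k₂ + 1)) (hj : 1 ≤ j.val) : q' j = (A - q 0 - c j) / 2 := by
    have h := act (hrest j hj).2 (congrFun h1 j)
    rw [erase_sum, q_succ, (hrest j hj).1] at h
    linarith
  rw [erase_sum] at hq0 hq'0
  have q'_succ : ∑ j : Fin k₂, q' j.succ
      = (k₂ * (A - q 0) - ∑ j : Fin k₂, c j.succ) / 2 := by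
    rw [Finset.sum_congr rfl fun j _ => hq'j j.succ (succ_pos j), ← Finset.sum_div,
      Finset.sum_sub_distrib]
    simp [mul_sub]
  have hk : (4 - (k₂ : ℝ)) ≠ 0 := sub_ne_zero.mpr (by exact_mod_cast hk₂4.symm)
  refine ⟨?_, by linarith, hq'j⟩
  rw [filter_sum, eq_div_iff hk]
  rw [q'_succ] at hq0
  linarith
end
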